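/- arXiv:2404.02498 — 2 statements merged into one kernel-verified Lean document; each statement's English description precedes it below -/
import Mathlib

section
/- Let ω = ⌈(T+1)/ϱ⌉. For every integer m with 1 ≤ m ≤ ω − 1 and every t with 0 ≤ t ≤ T, the (2m−1)-fold iterate satisfies Φ^{2m−1}(δ_T)(t) = 1 if and only if either t ≤ T − m·ϱ, or T − t = i·ϱ for some integer i with 0 ≤ i ≤ m−1. -/
/-- `nextStop T s t = σ_s(t) = min {u : t < u ≤ T, s u = 1}`, the first stopping time of the
pure stopping strategy `s : {0,…,T} → {0,1}` strictly after time `t`. -/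
noncomputable def nextStop (T : ℕ) (s : ℕ → Bool) (t : ℕ) : ℕ :=
  sInf {u : ℕ | t < u ∧ u ≤ T ∧ s u = true}

/-- The training operator `Φ` of the immediate-cost problem: `Φ(s)(T) = 1` and, for `t < T`,
`Φ(s)(t) = 1` if `σ_s(t) − t ≥ ϱ` and `Φ(s)(t) = 0` otherwise. -/
noncomputable def Phi (T ϱ : ℕ) (s : ℕ → Bool) : ℕ → Bool :=
  fun t => if t < T then decide (ϱ ≤ nextStop T s t - t) else true

/-- At `t < T`, the trained strategy stops iff `s` does not stop within the next `ϱ - 1` steps. -/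
theorem Phi_eq_true_iff {T ϱ : ℕ} {s : ℕ → Bool} (hs : s T = true) {t : ℕ} (ht : t < T) :
    Phi T ϱ s t = true ↔ ∀ u, t < u → u < t + ϱ → u ≤ T → s u ≠ true := by
  have hne : {u : ℕ | t < u ∧ u ≤ T ∧ s u = true}.Nonempty := ⟨T, ht, le_rfl, hs⟩
  have hmem : t < nextStop T s t ∧ nextStop T s t ≤ T ∧ s (nextStop T s t) = true :=
    Nat.sInf_mem hne
  simp only [Phi, ht, if_true, decide_eq_true_eq]
  constructor
  · intro h u htu hu huT hsu
    have hle : nextStop T s t ≤ u := Nat.sInf_le ⟨htu, huT, hsu⟩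
    omega
  · intro h
    by_contra hlt
    exact h _ hmem.1 (by omega) hmem.2.1 hmem.2.2

theorem Phi_self (T ϱ : ℕ) (s : ℕ → Bool) : Phi T ϱ s T = true := by
  simp [Phi]

/-- If `s` stops exactly at the times `T - i * ϱ` with `i ≤ m`, then `Phi T ϱ s` stops exactly at
these times and at all times at distance at least `(m + 1) * ϱ` from `T`. -/
theorem Phi_of_multiples {T ϱ m : ℕ} (hϱ : 0 < ϱ) {s : ℕ → Bool}
    (hs : ∀ t ≤ T, (s t = true ↔ ∃ i ≤ m, T - t = i * ϱ)) {t : ℕ} (ht : t ≤ T) :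
    Phi T ϱ s t = true ↔ (m + 1) * ϱ ≤ T - t ∨ ∃ i ≤ m, T - t = i * ϱ := by
  obtain rfl | htT := ht.eq_or_lt
  · simpa [Phi_self] using Or.inr ⟨0, by simp⟩
  rw [Phi_eq_true_iff ((hs T le_rfl).2 ⟨0, by simp⟩) htT]
  constructor
  · intro h
    by_contra! hcon
    obtain ⟨hlt, hmul⟩ := hcon
    have hi : (T - t) / ϱ ≤ m := Nat.lt_succ_iff.1 ((Nat.div_lt_iff_lt_mul hϱ).2 hlt)
    have hdiv := Nat.div_add_mod' (T - t) ϱ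
    have hmod := Nat.mod_lt (T - t) hϱ
    have hnm := hmul _ hi
    exact h (T - (T - t) / ϱ * ϱ) (by omega) (by omega) (by omega)
      ((hs _ (by omega)).2 ⟨_, hi, by omega⟩)
  · intro h u htu hu huT hsu
    obtain ⟨i, hi, hiu⟩ := (hs u huT).1 hsu
    obtain h | ⟨j, -, hj⟩ := h
    · have := Nat.mul_le_mul_right ϱ hi
      rw [add_one_mul] at h
      omega
    · have hij : i < j := lt_of_mul_lt_mul_right (a := ϱ) (by omega) (Nat.zero_le _)
      have := Nat.mul_le_mul_right ϱ (Nat.succ_le_of_lt hij)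
      rw [Nat.succ_mul] at this
      omega

/-- If `s` stops exactly at the times `T - i * ϱ` with `i ≤ m` and at all times at distance at
least `(m + 1) * ϱ` from `T`, then `Phi T ϱ s` stops exactly at the times `T - i * ϱ` with
`i ≤ m + 1`. -/
theorem Phi_of_tail_or_multiples {T ϱ m : ℕ} (hϱ : 2 ≤ ϱ) {s : ℕ → Bool}
    (hs : ∀ t ≤ T, (s t = true ↔ (m + 1) * ϱ ≤ T - t ∨ ∃ i ≤ m, T - t = i * ϱ))
    {t : ℕ} (ht : t ≤ T) :
    Phi T ϱ s t = true ↔ ∃ i ≤ m + 1, T - t = i * ϱ := by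
  obtain rfl | htT := ht.eq_or_lt
  · simpa [Phi_self] using ⟨0, by simp⟩
  rw [Phi_eq_true_iff ((hs T le_rfl).2 (Or.inr ⟨0, by simp⟩)) htT]
  constructor
  · intro h
    by_contra! hmul
    obtain hlt | hge := lt_or_ge (T - t) ((m + 1) * ϱ)
    · have hi : (T - t) / ϱ ≤ m :=
        Nat.lt_succ_iff.1 ((Nat.div_lt_iff_lt_mul (by omega)).2 hlt)
      have hdiv := Nat.div_add_mod' (T - t) ϱ
      have hmod := Nat.mod_lt (T - t) (y := ϱ) (by omega)
      have hnm := hmul _ (hi.trans (Nat.le_succ m))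
      exact h (T - (T - t) / ϱ * ϱ) (by omega) (by omega) (by omega)
        ((hs _ (by omega)).2 (Or.inr ⟨_, hi, by omega⟩))
    · have hnm := hmul (m + 1) le_rfl
      exact h (t + 1) (by omega) (by omega) (by omega) ((hs _ (by omega)).2 (Or.inl (by omega)))
  · rintro ⟨j, hjm, hj⟩ u htu hu huT hsu
    obtain h | ⟨i, hi, hiu⟩ := (hs u huT).1 hsu
    · have := Nat.mul_le_mul_right ϱ hjm
      omega
    · have hij : i < j := lt_of_mul_lt_mul_right (a := ϱ) (by omega) (Nat.zero_le _)
      have := Nat.mul_le_mul_right ϱ (Nat.succ_le_of_lt hij)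
      rw [Nat.succ_mul] at this
      omega

/-- The `2 * m`-fold iterate stops exactly at the times `T - i * ϱ` with `i ≤ m`. -/
theorem even_iterates_of_training {T ϱ : ℕ} (hϱ : 2 ≤ ϱ) (m : ℕ) :
    ∀ t ≤ T, ((Phi T ϱ)^[2 * m] (fun u => decide (u = T)) t = true ↔
      ∃ i ≤ m, T - t = i * ϱ) := by
  induction m with
  | zero =>
    intro t ht
    simp
    omega
  | succ m ih =>
    intro t ht
    rw [show 2 * (m + 1) = 2 * m + 1 + 1 by ring, Function.iterate_succ_apply',
      Function.iterate_succ_apply']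
    exact Phi_of_tail_or_multiples hϱ (fun u hu => Phi_of_multiples (by omega) ih hu) ht

/-- Fix an integer horizon `T ≥ 1` and an integer `ϱ ≥ 2`, let `δ_T` be the strategy with
`δ_T(t) = 1` iff `t = T`, and let `ω = ⌈(T+1)/ϱ⌉` (ceiling division).  For every integer
`m` with `1 ≤ m ≤ ω − 1` and every `t` with `0 ≤ t ≤ T`, the `(2m−1)`-fold iterate
satisfies `Φ^{2m−1}(δ_T)(t) = 1` if and only if either `t ≤ T − m·ϱ`, or `T − t = i·ϱ` for
some integer `i` with `0 ≤ i ≤ m − 1`. -/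
theorem odd_iterates_of_training
    (T ϱ : ℕ) (hT : 1 ≤ T) (hϱ : 2 ≤ ϱ) (ω : ℕ) (hω : ω = (T + 1 + ϱ - 1) / ϱ) :
    ∀ m : ℕ, 1 ≤ m → m ≤ ω - 1 → ∀ t : ℕ, t ≤ T →
      ((Phi T ϱ)^[2 * m - 1] (fun u => decide (u = T)) t = true ↔
        (t ≤ T - m * ϱ ∨ ∃ i : ℕ, i ≤ m - 1 ∧ T - t = i * ϱ)) := by
  rintro m hm hmω t ht
  obtain ⟨k, rfl⟩ : ∃ k, m = k + 1 := ⟨m - 1, by omega⟩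
  have hω' : ω = T / ϱ + 1 := by
    rw [hω, show T + 1 + ϱ - 1 = T + ϱ by omega, Nat.add_div_right _ (by omega)]
  have hkT : (k + 1) * ϱ ≤ T := (Nat.le_div_iff_mul_le (by omega)).1 (by omega)
  rw [show 2 * (k + 1) - 1 = 2 * k + 1 by omega, Function.iterate_succ_apply',
    Phi_of_multiples (by omega) (even_iterates_of_training hϱ k) ht, Nat.add_sub_cancel]
  exact or_congr (by omega) Iff.rfl
end

section
/- Assume θ ≥ β > θ^T and let ν = ⌊log β / log θ⌋. Then for every integer j ≥ 1, θ^j ≥ β if and only if j ≤ ν; consequently, for every time t with 0 ≤ t ≤ T, the plan δ₀ that stops immediately is a maximizer of V_t over all randomized stopping plans at time t if and only if T − t ≤ ν, and if T − t > ν then the plan δ_{T−t} that stops at time T is the unique maximizer. In particular, the naive agent's actual strategy stops at time t if and only if T − t ≤ ν. -/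
/-- Present-biased preference value with immediate reward: for a randomized stopping plan
`p = (p 0, …, p (T-t))` at time `t`,
`V_t(p) = θ^{−t}·(θ^T v·p 0 + Σ_{j=1}^{T−t} β θ^{T−j} v·p j)`. -/
noncomputable def rewardVal (T : ℕ) (v θ β : ℝ) (t : ℕ) (p : ℕ → ℝ) : ℝ :=
  (θ ^ t)⁻¹ * (θ ^ T * v * p 0 + ∑ j ∈ Finset.Icc 1 (T - t), β * θ ^ (T - j) * v * p j)

open Finset

/-- The coefficient of `p j` in `rewardVal`, without the normalization `(θ ^ t)⁻¹`. -/
noncomputable def rewardCoeff (T : ℕ) (v θ β : ℝ) (j : ℕ) : ℝ :=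
  if j = 0 then θ ^ T * v else β * θ ^ (T - j) * v

lemma rewardVal_eq_sum (T : ℕ) (v θ β : ℝ) (t : ℕ) (p : ℕ → ℝ) :
    rewardVal T v θ β t p =
      (θ ^ t)⁻¹ * ∑ j ∈ range (T - t + 1), rewardCoeff T v θ β j * p j := by
  rw [rewardVal, sum_range_succ', add_comm (θ ^ T * v * p 0)]
  congr 2
  rw [← Ico_add_one_right_eq_Icc, sum_Ico_eq_sum_range]
  simp [rewardCoeff, add_comm 1]

lemma rewardVal_dirac (T : ℕ) (v θ β : ℝ) (t : ℕ) {k : ℕ} (hk : k ≤ T - t) :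
    rewardVal T v θ β t (fun j => if j = k then 1 else 0) =
      (θ ^ t)⁻¹ * rewardCoeff T v θ β k := by
  rw [rewardVal_eq_sum]
  simp [Nat.lt_succ_of_le hk]

lemma sum_mul_le_of_forall_le {ι : Type*} {s : Finset ι} {c p : ι → ℝ} {M : ℝ}
    (hp : ∀ i ∈ s, 0 ≤ p i) (hsum : ∑ i ∈ s, p i = 1) (hc : ∀ i ∈ s, c i ≤ M) :
    ∑ i ∈ s, c i * p i ≤ M :=
  calc ∑ i ∈ s, c i * p i ≤ ∑ i ∈ s, M * p i :=
        sum_le_sum fun i hi => mul_le_mul_of_nonneg_right (hc i hi) (hp i hi)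
    _ = M := by rw [← mul_sum, hsum, mul_one]

lemma eq_dirac_of_sum_mul_eq {ι : Type*} [DecidableEq ι] {s : Finset ι} {c p : ι → ℝ} {k : ι}
    (hp : ∀ i ∈ s, 0 ≤ p i) (hsum : ∑ i ∈ s, p i = 1) (hk : k ∈ s)
    (hc : ∀ i ∈ s, i ≠ k → c i < c k) (heq : ∑ i ∈ s, c i * p i = c k) :
    ∀ i ∈ s, p i = if i = k then 1 else 0 := by
  have hdiff : ∑ i ∈ s, (c k - c i) * p i = 0 := by
    simp_rw [sub_mul]
    rw [sum_sub_distrib, ← mul_sum, hsum, heq, mul_one, sub_self]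
  have hterm : ∀ i ∈ s, 0 ≤ (c k - c i) * p i := by
    intro i hi
    by_cases hik : i = k
    · simp [hik]
    · exact mul_nonneg (sub_pos.2 (hc i hi hik)).le (hp i hi)
  have hzero : ∀ i ∈ s, i ≠ k → p i = 0 := fun i hi hik =>
    (mul_eq_zero.1 ((sum_eq_zero_iff_of_nonneg hterm).1 hdiff i hi)).resolve_left
      (sub_pos.2 (hc i hi hik)).ne'
  intro i hi
  split_ifs with hik
  · rw [hik, ← hsum]
    exact (sum_eq_single_of_mem k hk hzero).symm
  · exact hzero i hi hik

lemma le_pow_iff_le_floor_log_div_log {θ β : ℝ} (hθ0 : 0 < θ) (hθ1 : θ < 1) (hβ0 : 0 < β)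
    (j : ℕ) : β ≤ θ ^ j ↔ (j : ℤ) ≤ ⌊Real.log β / Real.log θ⌋ := by
  rw [Int.le_floor, Int.cast_natCast, le_div_iff_of_neg (Real.log_neg hθ0 hθ1),
    ← Real.log_pow, Real.log_le_log_iff hβ0 (pow_pos hθ0 j)]

lemma rewardCoeff_le_zero_iff {T : ℕ} {v θ β : ℝ} (hv : 0 < v) (hθ0 : 0 < θ) {j : ℕ}
    (hj : j ≠ 0) (hjT : j ≤ T) :
    rewardCoeff T v θ β j ≤ rewardCoeff T v θ β 0 ↔ β ≤ θ ^ j := by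
  have hpow : θ ^ T = θ ^ j * θ ^ (T - j) := by rw [← pow_add, Nat.add_sub_cancel' hjT]
  simp only [rewardCoeff, if_neg hj, if_true]
  rw [hpow, mul_le_mul_iff_left₀ hv, mul_le_mul_iff_left₀ (pow_pos hθ0 _)]

lemma rewardCoeff_lt_rewardCoeff {T : ℕ} {v θ β : ℝ} (hv : 0 < v) (hθ0 : 0 < θ) (hθ1 : θ < 1)
    (hβ0 : 0 < β) {i j : ℕ} (hi : i ≠ 0) (hij : i < j) (hjT : j ≤ T) :
    rewardCoeff T v θ β i < rewardCoeff T v θ β j := by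
  simp only [rewardCoeff, if_neg hi, if_neg (Nat.ne_zero_of_lt hij)]
  have := pow_lt_pow_right_of_lt_one₀ hθ0 hθ1 (show T - j < T - i by omega)
  gcongr

/-- Fix an integer horizon `T ≥ 1` and reals `v > 0`, `θ ∈ (0,1)`, `β ∈ (0,1]`.
Assume `θ ≥ β > θ^T` and let `ν = ⌊log β / log θ⌋`.  Then for every integer `j ≥ 1`,
`θ^j ≥ β` iff `j ≤ ν`; consequently, for every time `0 ≤ t ≤ T`, the plan `δ₀` that stops
immediately is a maximizer of `V_t` over all randomized stopping plans at time `t` iff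
`T − t ≤ ν`, and if `T − t > ν` then the plan `δ_{T−t}` that stops at time `T` is the
unique maximizer.  In particular, the naive agent's actual strategy stops at time `t` iff
`T − t ≤ ν`. -/
theorem immediate_reward_nu_threshold
    (T : ℕ) (hT : 1 ≤ T) (v θ β : ℝ) (hv : 0 < v)
    (hθ0 : 0 < θ) (hθ1 : θ < 1) (hβ0 : 0 < β) (hβ1 : β ≤ 1)
    (h1 : β ≤ θ) (h2 : θ ^ T < β) (ν : ℤ) (hν : ν = ⌊Real.log β / Real.log θ⌋) :
    (∀ j : ℕ, 1 ≤ j → (β ≤ θ ^ j ↔ (j : ℤ) ≤ ν)) ∧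
    (∀ t : ℕ, t ≤ T →
      ((∀ p : ℕ → ℝ,
          (∀ j : ℕ, j ≤ T - t → 0 ≤ p j) →
          (∑ j ∈ Finset.range (T - t + 1), p j) = 1 →
          rewardVal T v θ β t p ≤
            rewardVal T v θ β t (fun j => if j = 0 then 1 else 0)) ↔
        ((T : ℤ) - (t : ℤ) ≤ ν))) ∧
    (∀ t : ℕ, t ≤ T → ν < (T : ℤ) - (t : ℤ) →
      ∀ p : ℕ → ℝ,
        (∀ j : ℕ, j ≤ T - t → 0 ≤ p j) →
        (∑ j ∈ Finset.range (T - t + 1), p j) = 1 →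
        (rewardVal T v θ β t p ≤
            rewardVal T v θ β t (fun j => if j = T - t then 1 else 0) ∧
         (rewardVal T v θ β t p =
            rewardVal T v θ β t (fun j => if j = T - t then 1 else 0) →
           ∀ j : ℕ, j ≤ T - t → p j = if j = T - t then 1 else 0))) := by
  subst hν
  have hthr := le_pow_iff_le_floor_log_div_log hθ0 hθ1 hβ0
  have hpos : ∀ t : ℕ, 0 < (θ ^ t)⁻¹ := fun t => inv_pos.2 (pow_pos hθ0 t)
  refine ⟨fun j _ => hthr j, fun t ht => ?_, fun t ht hlt p hp hsum => ?_⟩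
  · rw [← Nat.cast_sub ht, ← hthr, rewardVal_dirac T v θ β t (Nat.zero_le _)]
    constructor
    · intro h
      rcases Nat.eq_zero_or_pos (T - t) with hm | hm
      · simpa [hm] using hβ1
      · rw [← rewardCoeff_le_zero_iff hv hθ0 hm.ne' (Nat.sub_le T t)]
        have hle := h (fun j => if j = T - t then 1 else 0)
          (fun j _ => by split_ifs <;> norm_num) (by simp)
        rwa [rewardVal_dirac T v θ β t le_rfl, mul_le_mul_iff_right₀ (hpos t)] at hle
    · intro h p hp hsum
      rw [rewardVal_eq_sum, mul_le_mul_iff_right₀ (hpos t)]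
      refine sum_mul_le_of_forall_le (fun j hj => hp j (mem_range_succ_iff.1 hj)) hsum
        fun j hj => ?_
      have hj := mem_range_succ_iff.1 hj
      rcases eq_or_ne j 0 with rfl | hj0
      · exact le_rfl
      · exact (rewardCoeff_le_zero_iff hv hθ0 hj0 (hj.trans (Nat.sub_le T t))).2
          (h.trans (pow_le_pow_of_le_one hθ0.le hθ1.le hj))
  · rw [← Nat.cast_sub ht, ← not_le, ← hthr] at hlt
    have hm : T - t ≠ 0 := fun hm => hlt (by simpa [hm] using hβ1)
    have hc : ∀ j ∈ range (T - t + 1), j ≠ T - t →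
        rewardCoeff T v θ β j < rewardCoeff T v θ β (T - t) := by
      intro j hj hjm
      rcases eq_or_ne j 0 with rfl | hj0
      · rw [← not_le, rewardCoeff_le_zero_iff hv hθ0 hm (Nat.sub_le T t)]
        exact hlt
      · exact rewardCoeff_lt_rewardCoeff hv hθ0 hθ1 hβ0 hj0
          (lt_of_le_of_ne (mem_range_succ_iff.1 hj) hjm) (Nat.sub_le T t)
    have hp' : ∀ j ∈ range (T - t + 1), 0 ≤ p j := fun j hj => hp j (mem_range_succ_iff.1 hj)
    rw [rewardVal_dirac T v θ β t le_rfl, rewardVal_eq_sum, mul_le_mul_iff_right₀ (hpos t),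
      mul_right_inj' (hpos t).ne']
    refine ⟨sum_mul_le_of_forall_le hp' hsum fun j hj => ?_, fun heq j hj =>
      eq_dirac_of_sum_mul_eq hp' hsum (self_mem_range_succ _) hc heq j
        (mem_range_succ_iff.2 hj)⟩
    rcases eq_or_ne j (T - t) with rfl | hjm
    · exact le_rfl
    · exact (hc j hj hjm).le
end
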